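/- Let H ∈ (3/4, 1) and θ > 0. Then lim_{T → ∞} T^{2-4H} ∫_{[0,T]^3} e^{-θ|x-y|} |x-z|^{2H-2} |y-z|^{2H-2} dx dy dz = 4 θ^{-1} / ((4H-2)(4H-3)). -/

import Mathlib

open MeasureTheory

theorem intervalIntegrable_comp_abs_sub {f : ℝ → ℝ} (hf : ∀ s t, IntervalIntegrable f volume s t)
    {T x : ℝ} (hx : x ∈ Set.Icc 0 T) :
    IntervalIntegrable (fun y => f |x - y|) volume 0 x ∧
      IntervalIntegrable (fun y => f |x - y|) volume x T := by
  constructor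
  · have h := (hf x 0).comp_sub_left x
    rw [sub_self, sub_zero] at h
    refine h.congr fun y hy => ?_
    rw [Set.uIoc_of_le hx.1] at hy
    simp only [abs_of_nonneg (sub_nonneg.2 hy.2)]
  · have h := (hf 0 (T - x)).comp_sub_right x
    rw [zero_add, sub_add_cancel] at h
    refine h.congr fun y hy => ?_
    rw [Set.uIoc_of_le hx.2] at hy
    simp only [abs_of_nonpos (sub_nonpos.2 hy.1.le), neg_sub]

theorem integral_comp_abs_sub {f : ℝ → ℝ} (hf : ∀ s t, IntervalIntegrable f volume s t)
    {T x : ℝ} (hx : x ∈ Set.Icc 0 T) :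
    ∫ y in (0:ℝ)..T, f |x - y| = (∫ u in (0:ℝ)..x, f u) + ∫ u in (0:ℝ)..(T - x), f u := by
  have h := intervalIntegrable_comp_abs_sub hf hx
  rw [← intervalIntegral.integral_add_adjacent_intervals h.1 h.2]
  congr 1
  · have e : ∫ y in (0:ℝ)..x, f |x - y| = ∫ y in (0:ℝ)..x, f (x - y) := by
      refine intervalIntegral.integral_congr fun y hy => ?_
      rw [Set.uIcc_of_le hx.1] at hy
      simp only [abs_of_nonneg (sub_nonneg.2 hy.2)]
    rw [e, intervalIntegral.integral_comp_sub_left]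
    simp
  · have e : ∫ y in x..T, f |x - y| = ∫ y in x..T, f (y - x) := by
      refine intervalIntegral.integral_congr fun y hy => ?_
      rw [Set.uIcc_of_le hx.2] at hy
      simp only [abs_of_nonpos (sub_nonpos.2 hy.1), neg_sub]
    rw [e, intervalIntegral.integral_comp_sub_right]
    simp

theorem integral_exp_neg_mul {c : ℝ} (hc : 0 < c) (t : ℝ) :
    ∫ u in (0:ℝ)..t, Real.exp (-c * u) = (1 - Real.exp (-c * t)) / c := by
  rw [intervalIntegral.integral_comp_mul_left (fun u => Real.exp u) (neg_ne_zero.2 hc.ne'),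
    integral_exp]
  simp only [mul_zero, Real.exp_zero, smul_eq_mul]
  field_simp
  ring

theorem integral_exp_neg_mul_abs_sub {c T x : ℝ} (hc : 0 < c) (hx : x ∈ Set.Icc 0 T) :
    ∫ y in (0:ℝ)..T, Real.exp (-c * |x - y|)
      = (2 - Real.exp (-c * x) - Real.exp (-c * (T - x))) / c := by
  have hf : ∀ s t, IntervalIntegrable (fun u : ℝ => Real.exp (-c * u)) volume s t :=
    fun s t => Continuous.intervalIntegrable (by fun_prop) s t
  rw [integral_comp_abs_sub hf hx, integral_exp_neg_mul hc, integral_exp_neg_mul hc]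
  ring

theorem intervalIntegrable_rpow_abs_sub {r T x : ℝ} (hr : -1 < r) (hx : x ∈ Set.Icc 0 T) :
    IntervalIntegrable (fun z => |x - z| ^ r) volume 0 T :=
  have h := intervalIntegrable_comp_abs_sub
    (fun _ _ => intervalIntegral.intervalIntegrable_rpow' hr) hx
  h.1.trans h.2

theorem integral_rpow_abs_sub_add {r T x d : ℝ} (hr : -1 < r) (hx : x ∈ Set.Icc 0 T) :
    IntervalIntegrable (fun z => (|x - z| + d) ^ r) volume 0 T ∧
    ∫ z in (0:ℝ)..T, (|x - z| + d) ^ r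
      = ((x + d) ^ (r + 1) + (T - x + d) ^ (r + 1) - 2 * d ^ (r + 1)) / (r + 1) := by
  have hf : ∀ s t, IntervalIntegrable (fun u : ℝ => (u + d) ^ r) volume s t := fun s t => by
    have h := (intervalIntegral.intervalIntegrable_rpow'
      (a := s + d) (b := t + d) hr).comp_add_right d
    simpa using h
  have h := intervalIntegrable_comp_abs_sub hf hx
  refine ⟨h.1.trans h.2, ?_⟩
  rw [integral_comp_abs_sub hf hx,
    intervalIntegral.integral_comp_add_right (fun u => u ^ r),
    intervalIntegral.integral_comp_add_right (fun u => u ^ r),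
    integral_rpow (Or.inl hr), integral_rpow (Or.inl hr)]
  simp only [zero_add]
  ring

theorem integral_rpow_abs_sub {r T x : ℝ} (hr : -1 < r) (hx : x ∈ Set.Icc 0 T) :
    ∫ z in (0:ℝ)..T, |x - z| ^ r = (x ^ (r + 1) + (T - x) ^ (r + 1)) / (r + 1) := by
  have h := (integral_rpow_abs_sub_add (d := 0) hr hx).2
  simpa [Real.zero_rpow (by linarith : r + 1 ≠ 0)] using h

theorem rpow_abs_mul_le {a : ℝ} (s t : ℝ) :
    |s| ^ a * |t| ^ a ≤ (|s| ^ (2 * a) + |t| ^ (2 * a)) / 2 := by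
  have e : ∀ u : ℝ, |u| ^ (2 * a) = (|u| ^ a) ^ 2 := fun u => by
    rw [mul_comm, ← Real.rpow_mul_natCast (abs_nonneg u)]; norm_num
  rw [e, e]
  nlinarith [sq_nonneg (|s| ^ a - |t| ^ a)]

theorem rpow_abs_add_le_mul {a x y z : ℝ} (ha : a ≤ 0) (hx : x ≠ z) (hy : y ≠ z) :
    (|x - z| + |x - y|) ^ (2 * a) ≤ |x - z| ^ a * |y - z| ^ a := by
  have hxz : 0 < |x - z| := abs_pos.2 (sub_ne_zero.2 hx)
  have hyz : 0 < |y - z| := abs_pos.2 (sub_ne_zero.2 hy)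
  have hp : 0 < |x - z| + |x - y| := by positivity
  rw [two_mul, Real.rpow_add hp]
  have h1 : |y - z| ≤ |x - z| + |x - y| := by
    rw [abs_sub_comm x y, add_comm]; exact abs_sub_le y x z
  exact mul_le_mul (Real.rpow_le_rpow_of_nonpos hxz (by linarith [abs_nonneg (x - y)]) ha)
    (Real.rpow_le_rpow_of_nonpos hyz h1 ha) (by positivity) (by positivity)

theorem intervalIntegrable_rpow_mul_rpow {a T x y : ℝ} (ha : -(1 / 2) < a)
    (hx : x ∈ Set.Icc 0 T) (hy : y ∈ Set.Icc 0 T) :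
    IntervalIntegrable (fun z => |x - z| ^ a * |y - z| ^ a) volume 0 T := by
  have hr : -1 < 2 * a := by linarith
  refine (((intervalIntegrable_rpow_abs_sub hr hx).add
    (intervalIntegrable_rpow_abs_sub hr hy)).div_const 2).mono_fun
    (Measurable.aestronglyMeasurable (by fun_prop)) (Filter.Eventually.of_forall fun z => ?_)
  beta_reduce
  rw [Real.norm_of_nonneg (by positivity)]
  exact (rpow_abs_mul_le _ _).trans (le_abs_self _)

theorem rpow_le_rpow_add_rpow_abs_sub {b x y : ℝ} (hb : 0 ≤ b) (hb1 : b ≤ 1)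
    (hx : 0 ≤ x) (hy : 0 ≤ y) : y ^ b ≤ x ^ b + |x - y| ^ b := by
  refine le_trans (Real.rpow_le_rpow hy ?_ hb) (Real.rpow_add_le_add_rpow hx (abs_nonneg _) hb hb1)
  linarith [neg_abs_le (x - y)]

theorem abs_integral_rpow_mul_rpow_sub_le {a T x y : ℝ} (ha : -(1 / 2) < a) (ha0 : a ≤ 0)
    (hx : x ∈ Set.Icc 0 T) (hy : y ∈ Set.Icc 0 T) :
    |(∫ z in (0:ℝ)..T, |x - z| ^ a * |y - z| ^ a)
        - (x ^ (2 * a + 1) + (T - x) ^ (2 * a + 1)) / (2 * a + 1)|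
      ≤ 2 / (2 * a + 1) * |x - y| ^ (2 * a + 1) := by
  have hr : -1 < 2 * a := by linarith
  have hT : 0 ≤ T := hx.1.trans hx.2
  have hb : 0 < 2 * a + 1 := by linarith
  have hint := intervalIntegrable_rpow_mul_rpow ha hx hy
  have upper := intervalIntegral.integral_mono_on hT hint
    (((intervalIntegrable_rpow_abs_sub hr hx).add
      (intervalIntegrable_rpow_abs_sub hr hy)).div_const 2)
    (fun z _ => rpow_abs_mul_le (a := a) (x - z) (y - z))
  rw [intervalIntegral.integral_div, intervalIntegral.integral_add
    (intervalIntegrable_rpow_abs_sub hr hx) (intervalIntegrable_rpow_abs_sub hr hy),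
    integral_rpow_abs_sub hr hx, integral_rpow_abs_sub hr hy] at upper
  obtain ⟨hlint, hleq⟩ := integral_rpow_abs_sub_add (d := |x - y|) hr hx
  have lower := intervalIntegral.integral_mono_ae hT hlint hint (by
    filter_upwards [Measure.ae_ne volume x, Measure.ae_ne volume y] with z hzx hzy
    exact rpow_abs_add_le_mul ha0 hzx.symm hzy.symm)
  rw [hleq] at lower
  have h1 := rpow_le_rpow_add_rpow_abs_sub hb.le (by linarith) hx.1 hy.1
  have h2 := rpow_le_rpow_add_rpow_abs_sub hb.le (by linarith) (sub_nonneg.2 hx.2)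
    (sub_nonneg.2 hy.2)
  rw [show T - x - (T - y) = -(x - y) by ring, abs_neg] at h2
  have h3 : x ^ (2 * a + 1) ≤ (x + |x - y|) ^ (2 * a + 1) :=
    Real.rpow_le_rpow hx.1 (by linarith [abs_nonneg (x - y)]) hb.le
  have h4 : (T - x) ^ (2 * a + 1) ≤ (T - x + |x - y|) ^ (2 * a + 1) :=
    Real.rpow_le_rpow (sub_nonneg.2 hx.2) (by linarith [abs_nonneg (x - y)]) hb.le
  have h5 : 0 ≤ |x - y| ^ (2 * a + 1) := by positivity
  rw [abs_le]
  constructor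
  · refine le_trans (le_of_eq ?_) (sub_le_sub_right (le_trans (div_le_div_of_nonneg_right
      (sub_le_sub_right (add_le_add h3 h4) _) hb.le) lower) _)
    ring
  · have h6 : (y ^ (2 * a + 1) + (T - y) ^ (2 * a + 1)) / (2 * a + 1) ≤
      (x ^ (2 * a + 1) + |x - y| ^ (2 * a + 1) + ((T - x) ^ (2 * a + 1) + |x - y| ^ (2 * a + 1)))
        / (2 * a + 1) := div_le_div_of_nonneg_right (add_le_add h1 h2) hb.le
    have h7 : (x ^ (2 * a + 1) + |x - y| ^ (2 * a + 1) +
        ((T - x) ^ (2 * a + 1) + |x - y| ^ (2 * a + 1))) / (2 * a + 1)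
        = (x ^ (2 * a + 1) + (T - x) ^ (2 * a + 1)) / (2 * a + 1)
          + 2 / (2 * a + 1) * |x - y| ^ (2 * a + 1) := by ring
    have h8 : 0 ≤ 2 / (2 * a + 1) * |x - y| ^ (2 * a + 1) := by positivity
    linarith

theorem stronglyMeasurable_intervalIntegral {α : Type*} [MeasurableSpace α] {f : α → ℝ → ℝ}
    (hf : Measurable (Function.uncurry f)) (s t : ℝ) :
    StronglyMeasurable fun p => ∫ z in s..t, f p z :=
  hf.stronglyMeasurable.integral_prod_right.sub hf.stronglyMeasurable.integral_prod_right

theorem stronglyMeasurable_integral_rpow_mul_rpow (a T : ℝ) :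
    StronglyMeasurable fun p : ℝ × ℝ => ∫ z in (0:ℝ)..T, |p.1 - z| ^ a * |p.2 - z| ^ a :=
  stronglyMeasurable_intervalIntegral (by unfold Function.uncurry; fun_prop) 0 T

theorem exp_neg_mul_mul_rpow_le {θ b u : ℝ} (hθ : 0 < θ) (hb : 0 ≤ b) (hb1 : b ≤ 1)
    (hu : 0 ≤ u) :
    Real.exp (-θ * u) * u ^ b ≤ (1 + 2 / θ) * Real.exp (-(θ / 2) * u) := by
  have h1 : u ^ b ≤ 1 + u := by
    rcases le_total u 1 with h | h
    · linarith [Real.rpow_le_one hu h hb]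
    · have := Real.rpow_le_rpow_of_exponent_le h hb1
      rw [Real.rpow_one] at this
      linarith
  have h2 : 1 + u ≤ (1 + 2 / θ) * Real.exp (θ / 2 * u) := by
    have h3 : (1 + 2 / θ) * (θ / 2 * u + 1) ≤ (1 + 2 / θ) * Real.exp (θ / 2 * u) :=
      mul_le_mul_of_nonneg_left (Real.add_one_le_exp _) (by positivity)
    have h4 : (1 + 2 / θ) * (θ / 2 * u + 1) = 1 + u + (θ / 2 * u + 2 / θ) := by
      field_simp
      ring
    have h5 : 0 ≤ θ / 2 * u + 2 / θ := by positivity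
    linarith
  calc Real.exp (-θ * u) * u ^ b
      ≤ Real.exp (-θ * u) * ((1 + 2 / θ) * Real.exp (θ / 2 * u)) :=
        mul_le_mul_of_nonneg_left (h1.trans h2) (Real.exp_pos _).le
    _ = (1 + 2 / θ) * (Real.exp (-θ * u) * Real.exp (θ / 2 * u)) := by ring
    _ = (1 + 2 / θ) * Real.exp (-(θ / 2) * u) := by
        rw [← Real.exp_add]
        ring_nf

theorem intervalIntegrable_integral_rpow_mul_rpow {a T x : ℝ} (ha : -(1 / 2) < a) (ha0 : a ≤ 0)
    (hx : x ∈ Set.Icc 0 T) :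
    IntervalIntegrable (fun y => ∫ z in (0:ℝ)..T, |x - z| ^ a * |y - z| ^ a) volume 0 T := by
  have hT : 0 ≤ T := hx.1.trans hx.2
  have hb : 0 ≤ 2 * a + 1 := by linarith
  have hg : Continuous fun y : ℝ => (x ^ (2 * a + 1) + (T - x) ^ (2 * a + 1)) / (2 * a + 1)
      + 2 / (2 * a + 1) * |x - y| ^ (2 * a + 1) :=
    continuous_const.add (continuous_const.mul
      ((continuous_const.sub continuous_id).abs.rpow_const fun _ => Or.inr hb))
  refine (hg.intervalIntegrable 0 T).mono_fun
    ((stronglyMeasurable_integral_rpow_mul_rpow a T).comp_measurable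
      measurable_prodMk_left).aestronglyMeasurable ?_
  refine (ae_restrict_iff' measurableSet_uIoc).2 (Filter.Eventually.of_forall fun y hy => ?_)
  rw [Set.uIoc_of_le hT] at hy
  have h := (abs_le.1 (abs_integral_rpow_mul_rpow_sub_le ha ha0 hx ⟨hy.1.le, hy.2⟩)).2
  beta_reduce
  rw [Real.norm_of_nonneg (intervalIntegral.integral_nonneg hT fun z _ => by positivity)]
  refine le_trans ?_ (le_abs_self _)
  linarith

theorem abs_integral_exp_mul_integral_sub_le {a θ T x : ℝ} (ha : -(1 / 2) < a) (ha0 : a ≤ 0)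
    (hθ : 0 < θ) (hx : x ∈ Set.Icc 0 T) :
    |(∫ y in (0:ℝ)..T, Real.exp (-θ * |x - y|) *
          ∫ z in (0:ℝ)..T, |x - z| ^ a * |y - z| ^ a)
        - (x ^ (2 * a + 1) + (T - x) ^ (2 * a + 1)) / (2 * a + 1) *
          ((2 - Real.exp (-θ * x) - Real.exp (-θ * (T - x))) / θ)|
      ≤ 2 / (2 * a + 1) * (1 + 2 / θ) * (4 / θ) := by
  have hT : 0 ≤ T := hx.1.trans hx.2
  have hb : 0 < 2 * a + 1 := by linarith
  have he : ∀ c : ℝ, Continuous fun y : ℝ => Real.exp (-c * |x - y|) := fun c => by fun_prop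
  have hint := (intervalIntegrable_integral_rpow_mul_rpow ha ha0 hx).continuousOn_mul
    (he θ).continuousOn
  rw [← integral_exp_neg_mul_abs_sub hθ hx, ← intervalIntegral.integral_const_mul,
    ← intervalIntegral.integral_sub hint (((he θ).const_mul _).intervalIntegrable 0 T),
    ← Real.norm_eq_abs]
  refine (intervalIntegral.norm_integral_le_of_norm_le hT
    (g := fun y => 2 / (2 * a + 1) * (1 + 2 / θ) * Real.exp (-(θ / 2) * |x - y|))
    (Filter.Eventually.of_forall fun y hy => ?_)
    (((he (θ / 2)).const_mul _).intervalIntegrable 0 T)).trans ?_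
  · have h := abs_integral_rpow_mul_rpow_sub_le ha ha0 hx ⟨hy.1.le, hy.2⟩
    have h' := exp_neg_mul_mul_rpow_le hθ hb.le (by linarith) (abs_nonneg (x - y))
    rw [mul_comm _ (Real.exp _), ← mul_sub, norm_mul, Real.norm_eq_abs, Real.norm_eq_abs,
      Real.abs_exp]
    calc _ ≤ Real.exp (-θ * |x - y|) * (2 / (2 * a + 1) * |x - y| ^ (2 * a + 1)) :=
          mul_le_mul_of_nonneg_left h (Real.exp_pos _).le
      _ = 2 / (2 * a + 1) * (Real.exp (-θ * |x - y|) * |x - y| ^ (2 * a + 1)) := by ring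
      _ ≤ 2 / (2 * a + 1) * ((1 + 2 / θ) * Real.exp (-(θ / 2) * |x - y|)) :=
          mul_le_mul_of_nonneg_left h' (by positivity)
      _ = _ := by ring
  · rw [intervalIntegral.integral_const_mul, integral_exp_neg_mul_abs_sub (half_pos hθ) hx]
    refine mul_le_mul_of_nonneg_left ?_ (by positivity)
    rw [div_le_div_iff₀ (half_pos hθ) hθ]
    nlinarith [Real.exp_pos (-(θ / 2) * x), Real.exp_pos (-(θ / 2) * (T - x))]

theorem abs_integral_integral_exp_mul_integral_sub_le {a θ T : ℝ} (ha : -(1 / 2) < a)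
    (ha0 : a ≤ 0) (hθ : 0 < θ) (hT : 0 ≤ T) :
    |(∫ x in (0:ℝ)..T, ∫ y in (0:ℝ)..T, Real.exp (-θ * |x - y|) *
          ∫ z in (0:ℝ)..T, |x - z| ^ a * |y - z| ^ a)
        - 4 / θ / ((2 * a + 2) * (2 * a + 1)) * T ^ (2 * a + 2)|
      ≤ 2 / (2 * a + 1) * (1 + 2 / θ) * (4 / θ) * T
        + 4 / (2 * a + 1) / θ ^ 2 * T ^ (2 * a + 1) := by
  have hb : 0 < 2 * a + 1 := by linarith
  set b := 2 * a + 1 with hbdef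
  set C := 2 / b * (1 + 2 / θ) * (4 / θ)
  set G : ℝ → ℝ := fun x => ∫ y in (0:ℝ)..T, Real.exp (-θ * |x - y|) *
          ∫ z in (0:ℝ)..T, |x - z| ^ a * |y - z| ^ a
  have hpow1 : Continuous fun x : ℝ => x ^ b := continuous_id.rpow_const fun _ => Or.inr hb.le
  have hpow2 : Continuous fun x : ℝ => (T - x) ^ b :=
    (continuous_const.sub continuous_id).rpow_const fun _ => Or.inr hb.le
  have hh : Continuous fun x : ℝ => (x ^ b + (T - x) ^ b) / b := (hpow1.add hpow2).div_const b
  have hexp1 : Continuous fun x : ℝ => Real.exp (-θ * x) := by fun_prop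
  have hexp2 : Continuous fun x : ℝ => Real.exp (-θ * (T - x)) := by fun_prop
  have hGb : ∀ x ∈ Set.Ioc 0 T, |G x - 2 / θ * ((x ^ b + (T - x) ^ b) / b)| ≤
      C + 2 * T ^ b / b / θ * (Real.exp (-θ * x) + Real.exp (-θ * (T - x))) := by
    intro x hx
    have h1 := abs_integral_exp_mul_integral_sub_le ha ha0 hθ ⟨hx.1.le, hx.2⟩
    have h2 : (x ^ b + (T - x) ^ b) / b ≤ 2 * T ^ b / b := by
      refine div_le_div_of_nonneg_right ?_ hb.le
      linarith [Real.rpow_le_rpow hx.1.le hx.2 hb.le,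
        Real.rpow_le_rpow (sub_nonneg.2 hx.2) (sub_le_self T hx.1.le) hb.le]
    have h3 : 0 ≤ (x ^ b + (T - x) ^ b) / b :=
      div_nonneg (add_nonneg (Real.rpow_nonneg hx.1.le _)
        (Real.rpow_nonneg (sub_nonneg.2 hx.2) _)) hb.le
    have h4 : 0 ≤ (Real.exp (-θ * x) + Real.exp (-θ * (T - x))) / θ := by positivity
    have h5 := mul_le_mul_of_nonneg_right h2 h4
    have h6 := mul_nonneg h3 h4
    refine (abs_sub_le _ _ _).trans (add_le_add h1 ?_)
    rw [show (x ^ b + (T - x) ^ b) / b * ((2 - Real.exp (-θ * x) - Real.exp (-θ * (T - x))) / θ)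
      - 2 / θ * ((x ^ b + (T - x) ^ b) / b) = -((x ^ b + (T - x) ^ b) / b *
        ((Real.exp (-θ * x) + Real.exp (-θ * (T - x))) / θ)) by ring, abs_neg, abs_of_nonneg h6]
    exact h5.trans (le_of_eq (by ring))
  have hmain : Continuous fun x : ℝ => 2 / θ * ((x ^ b + (T - x) ^ b) / b) := hh.const_mul _
  have hexp : Continuous fun x : ℝ =>
      2 * T ^ b / b / θ * (Real.exp (-θ * x) + Real.exp (-θ * (T - x))) :=
    (hexp1.add hexp2).const_mul _
  have herr : Continuous fun x : ℝ =>
      C + 2 * T ^ b / b / θ * (Real.exp (-θ * x) + Real.exp (-θ * (T - x))) :=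
    continuous_const.add hexp
  have hGm : StronglyMeasurable G := by
    refine stronglyMeasurable_intervalIntegral (f := fun x y => Real.exp (-θ * |x - y|) *
      ∫ z in (0:ℝ)..T, |x - z| ^ a * |y - z| ^ a) ?_ 0 T
    exact Measurable.mul (by fun_prop) (stronglyMeasurable_integral_rpow_mul_rpow a T).measurable
  have hGi : IntervalIntegrable G volume 0 T := by
    have hd : IntervalIntegrable (fun x => G x - 2 / θ * ((x ^ b + (T - x) ^ b) / b))
        volume 0 T := by
      refine (herr.intervalIntegrable 0 T).mono_fun
        (hGm.sub hmain.stronglyMeasurable).aestronglyMeasurable ?_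
      refine (ae_restrict_iff' measurableSet_uIoc).2 (Filter.Eventually.of_forall fun x hx => ?_)
      rw [Set.uIoc_of_le hT] at hx
      exact (hGb x hx).trans (le_abs_self _)
    simpa using hd.add (hmain.intervalIntegrable 0 T)
  have hI1 : ∫ x in (0:ℝ)..T, 2 / θ * ((x ^ b + (T - x) ^ b) / b)
      = 4 / θ / ((2 * a + 2) * b) * T ^ (2 * a + 2) := by
    rw [intervalIntegral.integral_const_mul, intervalIntegral.integral_div,
      intervalIntegral.integral_add (hpow1.intervalIntegrable _ _) (hpow2.intervalIntegrable _ _),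
      intervalIntegral.integral_comp_sub_left (fun u => u ^ b), sub_self, sub_zero,
      integral_rpow (Or.inl (by linarith)), Real.zero_rpow (by linarith),
      show b + 1 = 2 * a + 2 by rw [hbdef]; ring]
    have : 2 * a + 2 ≠ 0 := by linarith
    field_simp
    ring
  have hI2 : ∫ x in (0:ℝ)..T,
      (C + 2 * T ^ b / b / θ * (Real.exp (-θ * x) + Real.exp (-θ * (T - x))))
      ≤ C * T + 4 / b / θ ^ 2 * T ^ b := by
    rw [intervalIntegral.integral_add intervalIntegrable_const
        (hexp.intervalIntegrable _ _),
      intervalIntegral.integral_const, intervalIntegral.integral_const_mul,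
      intervalIntegral.integral_add (hexp1.intervalIntegrable _ _) (hexp2.intervalIntegrable _ _),
      intervalIntegral.integral_comp_sub_left (fun u => Real.exp (-θ * u)), sub_self, sub_zero,
      integral_exp_neg_mul hθ, smul_eq_mul, mul_comm T C]
    have h1 : (1 - Real.exp (-θ * T)) / θ ≤ 1 / θ :=
      div_le_div_of_nonneg_right (by linarith [Real.exp_pos (-θ * T)]) hθ.le
    have h2 : 2 * T ^ b / b / θ * ((1 - Real.exp (-θ * T)) / θ + (1 - Real.exp (-θ * T)) / θ)
        ≤ 2 * T ^ b / b / θ * (1 / θ + 1 / θ) :=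
      mul_le_mul_of_nonneg_left (add_le_add h1 h1) (by positivity)
    have h3 : 2 * T ^ b / b / θ * (1 / θ + 1 / θ) = 4 / b / θ ^ 2 * T ^ b := by
      field_simp
      ring
    linarith
  rw [← hI1, ← intervalIntegral.integral_sub hGi (hmain.intervalIntegrable 0 T),
    ← Real.norm_eq_abs]
  exact (intervalIntegral.norm_integral_le_of_norm_le hT
    (Filter.Eventually.of_forall hGb) (herr.intervalIntegrable 0 T)).trans hI2

/-- Triple-integral limit underlying `lim_{T→∞} E[T^{1-2H} R₁ ·  F̃_T]` for `H ∈ (3/4, 1)`. -/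
theorem limit_triple_integral_Rosenblatt (H θ : ℝ) (hH : H ∈ Set.Ioo (3/4 : ℝ) 1)
    (hθ : 0 < θ) :
    Filter.Tendsto (fun T : ℝ =>
      T ^ (2 - 4*H) *
        ∫ x in (0:ℝ)..T, ∫ y in (0:ℝ)..T, ∫ z in (0:ℝ)..T,
          Real.exp (-θ * |x - y|) * |x - z| ^ (2*H - 2) * |y - z| ^ (2*H - 2))
      Filter.atTop (nhds (4 / θ / ((4*H - 2) * (4*H - 3)))) := by
  obtain ⟨hH1, hH2⟩ := hH
  set K := 2 / (4 * H - 3) * (1 + 2 / θ) * (4 / θ)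
  set L := 4 / (4 * H - 3) / θ ^ 2
  have hlim : Filter.Tendsto (fun T : ℝ => K * T ^ (-(4 * H - 3)) + L * T ^ (-1 : ℝ))
      Filter.atTop (nhds 0) := by
    simpa using ((tendsto_rpow_neg_atTop (by linarith : 0 < 4 * H - 3)).const_mul K).add
      ((tendsto_rpow_neg_atTop one_pos).const_mul L)
  refine tendsto_iff_norm_sub_tendsto_zero.2 (squeeze_zero' (Filter.Eventually.of_forall
    fun _ => norm_nonneg _) ?_ hlim)
  filter_upwards [Filter.eventually_gt_atTop 0] with T hT
  have h := abs_integral_integral_exp_mul_integral_sub_le (a := 2 * H - 2) (by linarith)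
    (by linarith) hθ hT.le
  rw [show 2 * (2 * H - 2) + 2 = 4 * H - 2 by ring,
    show 2 * (2 * H - 2) + 1 = 4 * H - 3 by ring] at h
  simp only [mul_assoc (Real.exp _), intervalIntegral.integral_const_mul]
  have e1 : T ^ (2 - 4 * H) * T ^ (4 * H - 2) = 1 := by
    rw [← Real.rpow_add hT]; simp
  have e2 : T ^ (2 - 4 * H) * T = T ^ (-(4 * H - 3)) := by
    rw [← Real.rpow_add_one hT.ne']; ring_nf
  have e3 : T ^ (2 - 4 * H) * T ^ (4 * H - 3) = T ^ (-1 : ℝ) := by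
    rw [← Real.rpow_add hT]; ring_nf
  set I := ∫ x in (0:ℝ)..T, ∫ y in (0:ℝ)..T, Real.exp (-θ * |x - y|) *
    ∫ z in (0:ℝ)..T, |x - z| ^ (2 * H - 2) * |y - z| ^ (2 * H - 2)
  set M := 4 / θ / ((4 * H - 2) * (4 * H - 3))
  have e4 : T ^ (2 - 4 * H) * I - M = T ^ (2 - 4 * H) * (I - M * T ^ (4 * H - 2)) := by
    linear_combination M * e1
  have hp : 0 ≤ T ^ (2 - 4 * H) := Real.rpow_nonneg hT.le _
  rw [e4, norm_mul, Real.norm_eq_abs, Real.norm_eq_abs, abs_of_nonneg hp]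
  refine (mul_le_mul_of_nonneg_left h hp).trans (le_of_eq ?_)
  linear_combination K * e2 + L * e3
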